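/- Let d ≥ 1, let μ_d be the uniform (unitarily invariant) probability measure on the unit sphere of ℂ^d, let ψ ∈ ℂ^d be a fixed unit vector, and let θ ∈ [0, 1]. Then μ_d({φ : |⟨ψ, φ⟩|² > θ/d}) ≥ (1 − θ)² · (d + 1)/(2d); in particular the right-hand side equals (1 − θ)²·(1/2 + 1/(2d)). (Haar-measure form of Fact C.2: with probability at least (1−θ)²(1/2 + 1/2^{n+1}), a random state on n qubits, d = 2^n, has squared overlap at least θ/2^n with any fixed pure state; it follows from the second- and fourth-moment identities via the Paley–Zygmund inequality.) -/

import Mathlib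

open Matrix MeasureTheory

/-- A unitary matrix whose distinguished row is `star v`. -/
lemma exists_unitary_row {d : ℕ} (i₀ : Fin d) (v : Fin d → ℂ) (hv : ∑ i, ‖v i‖ ^ 2 = 1) :
    ∃ U ∈ Matrix.unitaryGroup (Fin d) ℂ, ∀ φ : Fin d → ℂ, (U.mulVec φ) i₀ = star v ⬝ᵥ φ := by
  classical
  let w : Fin d → EuclideanSpace ℂ (Fin d) := fun _ => WithLp.toLp 2 v
  have hw : Orthonormal ℂ (Set.domRestrict {i₀} w) := by
    constructor
    · intro i
      change ‖(WithLp.toLp 2 v : EuclideanSpace ℂ (Fin d))‖ = 1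
      simp [EuclideanSpace.norm_eq, hv]
    · intro i j hij
      exact absurd (Subsingleton.elim i j) hij
  obtain ⟨b, hb⟩ := hw.exists_orthonormalBasis_extension_of_card_eq (by simp)
  refine ⟨Matrix.of fun i j => star (b i j), ?_, ?_⟩
  · rw [Matrix.mem_unitaryGroup_iff]
    ext i j
    have h := orthonormal_iff_ite.mp b.orthonormal i j
    simp only [PiLp.inner_apply, RCLike.inner_apply] at h
    simp only [Matrix.mul_apply, Matrix.star_apply, Matrix.of_apply, star_star, Matrix.one_apply]
    rw [← h]
    exact Finset.sum_congr rfl fun k _ => mul_comm _ _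
  · intro φ
    simp [Matrix.mulVec, dotProduct, hb i₀ rfl, w]

lemma four_phase (x y : ℂ) :
    ‖x + y‖ ^ 4 + ‖x - y‖ ^ 4 + ‖x + Complex.I * y‖ ^ 4 + ‖x - Complex.I * y‖ ^ 4
      = 4 * (‖x‖ ^ 4 + ‖y‖ ^ 4 + 4 * (‖x‖ ^ 2 * ‖y‖ ^ 2)) := by
  have h : ∀ z : ℂ, ‖z‖ ^ 4 = (‖z‖ ^ 2) ^ 2 := fun z => by ring
  simp only [h, Complex.sq_norm, Complex.normSq_apply]
  simp
  ring

lemma norm_sq_le_one {d : ℕ} (v φ : Fin d → ℂ) (hv : ∑ i, ‖v i‖ ^ 2 = 1)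
    (hφ : ∑ i, ‖φ i‖ ^ 2 = 1) : ‖star v ⬝ᵥ φ‖ ≤ 1 := by
  have h1 : ‖star v ⬝ᵥ φ‖ ≤ ∑ i, ‖v i‖ * ‖φ i‖ := by
    refine (norm_sum_le _ _).trans (le_of_eq ?_)
    simp
  have h2 := Finset.sum_mul_sq_le_sq_mul_sq Finset.univ (fun i => ‖v i‖) (fun i => ‖φ i‖)
  rw [hv, hφ] at h2
  have h3 : 0 ≤ ∑ i, ‖v i‖ * ‖φ i‖ := Finset.sum_nonneg fun i _ => by positivity
  nlinarith

theorem haar_overlap_anticoncentration (d : ℕ) (hd : 1 ≤ d)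
    (μ : Measure (Fin d → ℂ)) [IsProbabilityMeasure μ]
    (hsphere : μ {φ | ∑ i, ‖φ i‖ ^ 2 = 1} = 1)
    (hinv : ∀ U ∈ Matrix.unitaryGroup (Fin d) ℂ,
      μ.map (fun φ => U.mulVec φ) = μ)
    (ψ : Fin d → ℂ) (hψ : ∑ i, ‖ψ i‖ ^ 2 = 1)
    (θ : ℝ) (hθ0 : 0 ≤ θ) (hθ1 : θ ≤ 1) :
    ENNReal.ofReal ((1 - θ) ^ 2 * (d + 1) / (2 * d))
      ≤ μ {φ | θ / d < ‖star ψ ⬝ᵥ φ‖ ^ 2} := by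
  classical
  have hdpos : (0 : ℝ) < d := by exact_mod_cast hd
  have hae : ∀ᵐ φ ∂μ, ∑ i, ‖φ i‖ ^ 2 = 1 := by
    have hm : MeasurableSet {φ : Fin d → ℂ | ∑ i, ‖φ i‖ ^ 2 = 1} :=
      measurableSet_eq_fun (by fun_prop) (by fun_prop)
    exact (prob_compl_eq_zero_iff hm).mpr hsphere
  have hcont : ∀ v : Fin d → ℂ, Continuous fun φ : Fin d → ℂ => star v ⬝ᵥ φ := fun v => by
    unfold dotProduct; fun_prop
  let i₀ : Fin d := ⟨0, hd⟩
  have hmom : ∀ (n : ℕ) (v : Fin d → ℂ), ∑ i, ‖v i‖ ^ 2 = 1 →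
      ∫ φ, ‖star v ⬝ᵥ φ‖ ^ n ∂μ = ∫ φ, ‖φ i₀‖ ^ n ∂μ := by
    intro n v hv
    obtain ⟨U, hU, hrow⟩ := exists_unitary_row i₀ v hv
    conv_rhs => rw [← hinv U hU]
    rw [integral_map]
    · simp only [hrow]
    · exact (Continuous.matrix_mulVec continuous_const continuous_id).aemeasurable
    · exact Continuous.aestronglyMeasurable (by fun_prop)
  have hintv : ∀ (n : ℕ) (v : Fin d → ℂ), ∑ i, ‖v i‖ ^ 2 = 1 →
      Integrable (fun φ => ‖star v ⬝ᵥ φ‖ ^ n) μ := by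
    intro n v hv
    refine Integrable.of_bound ((hcont v).norm.pow n).aestronglyMeasurable 1 ?_
    filter_upwards [hae] with φ hφ
    rw [norm_pow, norm_norm]
    exact pow_le_one₀ (norm_nonneg _) (norm_sq_le_one v φ hv hφ)
  have he : ∀ i : Fin d, ∑ k, ‖(Pi.single i (1 : ℂ) : Fin d → ℂ) k‖ ^ 2 = 1 := by
    intro i
    rw [Finset.sum_eq_single i] <;> simp +contextual [Pi.single_apply]
  have hes : ∀ (i : Fin d) (φ : Fin d → ℂ),
      star (Pi.single i (1 : ℂ) : Fin d → ℂ) ⬝ᵥ φ = φ i := by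
    intro i φ
    simp [dotProduct, Pi.single_apply]
  have hintc : ∀ (n : ℕ) (i : Fin d), Integrable (fun φ : Fin d → ℂ => ‖φ i‖ ^ n) μ := by
    intro n i
    simpa only [hes] using hintv n _ (he i)
  have hmomc : ∀ (n : ℕ) (i : Fin d), ∫ φ, ‖φ i‖ ^ n ∂μ = ∫ φ, ‖φ i₀‖ ^ n ∂μ := by
    intro n i
    simpa only [hes] using hmom n _ (he i)
  have hle : ∀ φ : Fin d → ℂ, ∑ i, ‖φ i‖ ^ 2 = 1 → ∀ i, ‖φ i‖ ≤ 1 := by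
    intro φ hφ i
    simpa only [hes] using norm_sq_le_one _ φ (he i) hφ
  have hintm : ∀ i j : Fin d, Integrable (fun φ : Fin d → ℂ => ‖φ i‖ ^ 2 * ‖φ j‖ ^ 2) μ := by
    intro i j
    refine Integrable.of_bound (Continuous.aestronglyMeasurable (by fun_prop)) 1 ?_
    filter_upwards [hae] with φ hφ
    rw [Real.norm_of_nonneg (by positivity)]
    exact mul_le_one₀ (pow_le_one₀ (norm_nonneg _) (hle φ hφ i)) (by positivity)
      (pow_le_one₀ (norm_nonneg _) (hle φ hφ j))
  set m := ∫ φ, ‖φ i₀‖ ^ 2 ∂μ with hm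
  set q := ∫ φ, ‖φ i₀‖ ^ 4 ∂μ with hq
  have hm1 : d * m = 1 := by
    have h1 : ∫ φ, ∑ i : Fin d, ‖φ i‖ ^ 2 ∂μ = 1 := by
      rw [integral_congr_ae (g := fun _ => (1 : ℝ)) hae]; simp
    rw [integral_finsetSum _ fun i _ => hintc 2 i] at h1
    simpa [hmomc] using h1
  have hcross : ∀ i j : Fin d, i ≠ j → ∫ φ, ‖φ i‖ ^ 2 * ‖φ j‖ ^ 2 ∂μ = q / 2 := by
    intro i j hij
    have hc : ∀ c : ℂ, ‖c‖ = 1 →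
        Integrable (fun φ : Fin d → ℂ => ‖φ i + c * φ j‖ ^ 4) μ ∧
        ∫ φ, ‖φ i + c * φ j‖ ^ 4 ∂μ = 4 * q := by
      intro c hc
      let v : Fin d → ℂ := fun k =>
        ((Real.sqrt 2)⁻¹ : ℝ) * ((if k = i then 1 else 0) + (if k = j then star c else 0))
      have hs : (Real.sqrt 2) ^ 2 = 2 := Real.sq_sqrt (by norm_num)
      have hv : ∑ k, ‖v k‖ ^ 2 = 1 := by
        have : ∀ k, ‖v k‖ ^ 2 = (if k = i then 1 / 2 else 0) + (if k = j then 1 / 2 else 0) := by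
          intro k
          by_cases h1 : k = i
          · have h2 : k ≠ j := fun h => hij (h1.symm.trans h)
            simp [v, h1, hij, mul_pow]
          · by_cases h2 : k = j
            · simp [v, h2, hij.symm, mul_pow, hc]
            · simp [v, h1, h2]
        simp only [this, Finset.sum_add_distrib]
        simp; norm_num
      have hdot : ∀ φ : Fin d → ℂ, ‖star v ⬝ᵥ φ‖ ^ 4 = 1 / 4 * ‖φ i + c * φ j‖ ^ 4 := by
        intro φ
        have : star v ⬝ᵥ φ = ((Real.sqrt 2)⁻¹ : ℝ) * (φ i + c * φ j) := by
          simp only [v, dotProduct, Pi.star_apply, star_mul', star_add, apply_ite star, star_star,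
            star_one, star_zero, mul_assoc, add_mul, ← Finset.mul_sum, Finset.sum_add_distrib]
          simp
        rw [this, norm_mul, mul_pow, Complex.norm_real, Real.norm_of_nonneg (by positivity), inv_pow]
        have h4 : (Real.sqrt 2) ^ 4 = 4 := by
          rw [show (4 : ℕ) = 2 * 2 by rfl, pow_mul, hs]; norm_num
        rw [h4]; norm_num
      have hI := hintv 4 v hv
      have hM := hmom 4 v hv
      simp only [hdot] at hI hM
      rw [integral_const_mul] at hM
      constructor
      · have := hI.const_mul 4
        refine this.congr (Filter.Eventually.of_forall fun φ => ?_)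
        simp only []; ring
      · rw [← hq] at hM; linarith
    obtain ⟨I1, E1⟩ := hc 1 (by simp)
    obtain ⟨I2, E2⟩ := hc (-1) (by simp)
    obtain ⟨I3, E3⟩ := hc Complex.I (by simp)
    obtain ⟨I4, E4⟩ := hc (-Complex.I) (by simp)
    have hkey : ∫ φ : Fin d → ℂ, (‖φ i + 1 * φ j‖ ^ 4 + ‖φ i + (-1) * φ j‖ ^ 4
        + ‖φ i + Complex.I * φ j‖ ^ 4 + ‖φ i + (-Complex.I) * φ j‖ ^ 4) ∂μ
        = ∫ φ : Fin d → ℂ, 4 * (‖φ i‖ ^ 4 + ‖φ j‖ ^ 4 + 4 * (‖φ i‖ ^ 2 * ‖φ j‖ ^ 2)) ∂μ := by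
      congr 1
      ext φ
      rw [← four_phase]
      simp only [one_mul, neg_mul, sub_eq_add_neg]
    rw [integral_add ((I1.fun_add I2).fun_add I3) I4, integral_add (I1.fun_add I2) I3, integral_add I1 I2,
      E1, E2, E3, E4, integral_const_mul,
      integral_add ((hintc 4 i).fun_add (hintc 4 j)) ((hintm i j).const_mul 4),
      integral_add (hintc 4 i) (hintc 4 j), integral_const_mul, hmomc 4 i, hmomc 4 j] at hkey
    linarith
  have hq1 : d * (d + 1) * q = 2 := by
    have h1 : ∫ φ, ∑ i : Fin d, ∑ j : Fin d, ‖φ i‖ ^ 2 * ‖φ j‖ ^ 2 ∂μ = 1 := by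
      rw [integral_congr_ae (g := fun _ => (1 : ℝ))]
      · simp
      · filter_upwards [hae] with φ hφ
        rw [← Finset.sum_mul_sum, hφ, one_mul]
    rw [integral_finsetSum _ fun i _ => integrable_finsetSum _ fun j _ => hintm i j] at h1
    have h2 : ∀ i j : Fin d, ∫ φ, ‖φ i‖ ^ 2 * ‖φ j‖ ^ 2 ∂μ
        = q / 2 + if i = j then q / 2 else 0 := by
      intro i j
      by_cases h : i = j
      · subst h
        have h3 : ∫ φ, ‖φ i‖ ^ 2 * ‖φ i‖ ^ 2 ∂μ = q := by
          rw [hq, ← hmomc 4 i]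
          congr 1; ext φ; ring
        rw [h3]; simp
      · simp [hcross i j h, h]
    have h3 : ∀ i : Fin d, ∫ φ, ∑ j : Fin d, ‖φ i‖ ^ 2 * ‖φ j‖ ^ 2 ∂μ = d * (q / 2) + q / 2 := by
      intro i
      rw [integral_finsetSum _ fun j _ => hintm i j]
      simp [h2, Finset.sum_add_distrib]
    simp only [h3] at h1
    simp at h1
    linarith
  -- Paley-Zygmund
  set S := {φ : Fin d → ℂ | θ / d < ‖star ψ ⬝ᵥ φ‖ ^ 2} with hS
  have hSm : MeasurableSet S :=
    (isOpen_lt continuous_const ((hcont ψ).norm.pow 2)).measurableSet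
  have hEm : ∫ φ, ‖star ψ ⬝ᵥ φ‖ ^ 2 ∂μ = m := hmom 2 ψ hψ
  have hEq : ∫ φ, ‖star ψ ⬝ᵥ φ‖ ^ 4 ∂μ = q := hmom 4 ψ hψ
  set l : ℝ := (1 - θ) * (d + 1) / 2 with hl
  have hl0 : 0 ≤ l := by
    have : 0 ≤ 1 - θ := by linarith
    positivity
  have hIS : Integrable (S.indicator fun _ => (1 : ℝ)) μ :=
    (integrable_const (1 : ℝ)).indicator hSm
  have hpz : ∫ φ, 2 * l * ‖star ψ ⬝ᵥ φ‖ ^ 2 ∂μ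
      ≤ ∫ φ, (2 * l * (θ / d) + l ^ 2 * ‖star ψ ⬝ᵥ φ‖ ^ 4 + S.indicator (fun _ => (1 : ℝ)) φ) ∂μ := by
    refine integral_mono ((hintv 2 ψ hψ).const_mul _)
      (((integrable_const _).add ((hintv 4 ψ hψ).const_mul _)).add hIS) fun φ => ?_
    simp only []
    have ht : 0 ≤ 2 * l * (θ / d) := by positivity
    by_cases h : φ ∈ S
    · rw [Set.indicator_of_mem h]
      nlinarith [sq_nonneg (l * ‖star ψ ⬝ᵥ φ‖ ^ 2 - 1)]
    · rw [Set.indicator_of_notMem h]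
      have h' : ‖star ψ ⬝ᵥ φ‖ ^ 2 ≤ θ / d := not_lt.mp h
      have := mul_le_mul_of_nonneg_left h' (by positivity : 0 ≤ 2 * l)
      have : 0 ≤ l ^ 2 * ‖star ψ ⬝ᵥ φ‖ ^ 4 := by positivity
      linarith
  rw [integral_const_mul, integral_add ((integrable_const _).fun_add ((hintv 4 ψ hψ).const_mul _)) hIS,
    integral_add (integrable_const _) ((hintv 4 ψ hψ).const_mul _), integral_const_mul (l ^ 2), hEm, hEq,
    integral_indicator_const _ hSm] at hpz
  simp only [integral_const, probReal_univ, smul_eq_mul, one_mul, mul_one] at hpz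
  rw [← ofReal_measureReal (μ := μ) (s := S)]
  apply ENNReal.ofReal_le_ofReal
  have hmv : m = 1 / d := by field_simp; linarith
  have hqv : q = 2 / (d * (d + 1)) := by field_simp; linarith
  have hfin : 2 * l * m - 2 * l * (θ / d) - l ^ 2 * q = (1 - θ) ^ 2 * (d + 1) / (2 * d) := by
    rw [hmv, hqv, hl]; field_simp; ring
  linarith
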